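/- Let (U, τ) be a Curtis table for a based complex. For every i, the image of τ_i equals LT(im d_{i−1}), the set of leading indices of the nonzero boundaries in X_i. -/

import Mathlib

/-- The leading index (an element of `WithBot (Fin m)`, which is `⊥` exactly for the zero
vector) of a vector of the based `𝔽₂`-vector space `Fin m → ZMod 2`, whose ordered basis is
the standard one. -/
def lead {m : ℕ} (v : Fin m → ZMod 2) : WithBot (Fin m) :=
  (Finset.univ.filter fun j => v j ≠ 0).max

/-- `LTset S` is the set of leading indices of the nonzero elements of the subspace `S`. -/
def LTset {m : ℕ} (S : Submodule (ZMod 2) (Fin m → ZMod 2)) : Set (Fin m) :=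
  {j | ∃ v ∈ S, v ≠ 0 ∧ lead v = (j : WithBot (Fin m))}

/-- A based complex `X_0 → X_1 → ⋯ → X_N` of finite-dimensional `𝔽₂`-vector spaces with
ordered bases: `X_i` is modelled as `Fin (n i) → ZMod 2` via its ordered basis, and the
complex is extended by zero spaces in degrees `> N` (so `d_N = 0` holds automatically). -/
structure BasedComplex where
  N : ℕ
  n : ℕ → ℕ
  n_eq_zero : ∀ i, N < i → n i = 0
  d : ∀ i : ℕ, (Fin (n i) → ZMod 2) →ₗ[ZMod 2] (Fin (n (i + 1)) → ZMod 2)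
  d_comp : ∀ i, (d (i + 1)).comp (d i) = 0

namespace BasedComplex

/-- The cycles `ker d_i`. -/
def cyc (C : BasedComplex) (i : ℕ) : Submodule (ZMod 2) (Fin (C.n i) → ZMod 2) :=
  LinearMap.ker (C.d i)

/-- The boundaries `im d_{i-1}`, with the convention `d_{-1} = 0`. -/
def bdry (C : BasedComplex) : ∀ i : ℕ, Submodule (ZMod 2) (Fin (C.n i) → ZMod 2)
  | 0 => ⊥
  | (i + 1) => LinearMap.range (C.d i)

theorem bdry_zero (C : BasedComplex) : C.bdry 0 = ⊥ := rfl

theorem bdry_succ (C : BasedComplex) (i : ℕ) :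
    C.bdry (i + 1) = LinearMap.range (C.d i) := rfl

/-- The boundaries, viewed as a submodule of the cycles. -/
def bdryIn (C : BasedComplex) (i : ℕ) : Submodule (ZMod 2) (C.cyc i) :=
  (C.bdry i).comap (C.cyc i).subtype

/-- The homology `H_i = ker d_i / im d_{i-1}`. -/
abbrev homology (C : BasedComplex) (i : ℕ) :=
  C.cyc i ⧸ C.bdryIn i

end BasedComplex

/-- Given tag data `t`, where `t i k = some j` means that the basis index `k` of `X_i` is
tagged with target the basis index `j` of `X_{i+1}` (i.e. `τ_{i+1}(k) = j`),
`tagImage C t i` is the image of the partial function `τ_i` (which is empty for `i = 0`). -/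
def tagImage (C : BasedComplex) (t : ∀ i, Fin (C.n i) → Option (Fin (C.n (i + 1)))) :
    ∀ i : ℕ, Set (Fin (C.n i))
  | 0 => ∅
  | (i + 1) => {j | ∃ k, t i k = some j}

/-- A Curtis table for a based complex.  Here `t i` encodes the injective partial function
`τ_{i+1}` from the basis indices of `X_i` to the basis indices of `X_{i+1}`
(`t i k = some j` means `τ_{i+1}(k) = j`; the partial function `τ_0` is empty by
convention, and `τ_{N+1}` is automatically empty since `X_{N+1} = 0`). -/
structure CurtisTable (C : BasedComplex) where
  /-- the untagged items in each degree -/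
  U : ∀ i, Set (Fin (C.n i))
  /-- the tags -/
  t : ∀ i, Fin (C.n i) → Option (Fin (C.n (i + 1)))
  /-- the tags form an injective partial function -/
  t_inj : ∀ i k k' j, t i k = some j → t i k' = some j → k = k'
  /-- (i): `U_i` and the image of `τ_i` are disjoint … -/
  disj : ∀ i, Disjoint (U i) (tagImage C t i)
  /-- (i): … and their union is `LT(ker d_i)` -/
  union_eq : ∀ i, U i ∪ tagImage C t i = LTset (C.cyc i)
  /-- (ii): no index is both untagged and in the domain of `τ_{i+1}` -/
  mem_U_not_dom : ∀ i j, j ∈ U i → t i j = none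
  /-- (ii): no index is both in the image of `τ_i` and in the domain of `τ_{i+1}` -/
  mem_tagImage_not_dom : ∀ i j, j ∈ tagImage C t i → t i j = none
  /-- (ii): every basis index is untagged, or in the image of `τ_i`, or in the domain of
  `τ_{i+1}` -/
  cover : ∀ i j, j ∈ U i ∨ j ∈ tagImage C t i ∨ (t i j).isSome
  /-- (iii): if `τ_{i+1}(k) = j` then there is an `x` with leading index `k` such that
  `d_i x ≠ 0` and `d_i x` has leading index `j` -/
  tag_spec : ∀ i k j, t i k = some j →
    ∃ x : Fin (C.n i) → ZMod 2, lead x = (k : WithBot (Fin (C.n i))) ∧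
      C.d i x ≠ 0 ∧ lead (C.d i x) = (j : WithBot (Fin (C.n (i + 1))))

theorem lead_eq_coe_iff {m : ℕ} {v : Fin m → ZMod 2} {j : Fin m} :
    lead v = (j : WithBot (Fin m)) ↔ v j ≠ 0 ∧ ∀ k, j < k → v k = 0 := by
  unfold lead
  constructor
  · intro h
    refine ⟨(Finset.mem_filter.1 (Finset.mem_of_max h)).2, fun k hk => ?_⟩
    by_contra hv
    have := Finset.le_max_of_eq (Finset.mem_filter.2 ⟨Finset.mem_univ k, hv⟩) h
    exact absurd hk (not_lt.2 this)
  · rintro ⟨h, h'⟩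
    apply le_antisymm
    · refine Finset.max_le fun k hk => WithBot.coe_le_coe.2 (not_lt.1 fun hjk => ?_)
      exact (Finset.mem_filter.1 hk).2 (h' k hjk)
    · exact Finset.le_max (Finset.mem_filter.2 ⟨Finset.mem_univ j, h⟩)

theorem lead_lt_coe_iff {m : ℕ} {v : Fin m → ZMod 2} {j : Fin m} :
    lead v < (j : WithBot (Fin m)) ↔ ∀ k, j ≤ k → v k = 0 := by
  rw [lead, Finset.max_eq_sup_coe, Finset.sup_lt_iff (WithBot.bot_lt_coe j)]
  simp only [Finset.mem_filter, Finset.mem_univ, true_and, WithBot.coe_lt_coe]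
  exact forall_congr' fun k => by rw [← not_lt, not_imp_comm]

theorem lead_eq_bot_iff {m : ℕ} {v : Fin m → ZMod 2} : lead v = ⊥ ↔ v = 0 := by
  simp [lead, Finset.max_eq_bot, Finset.filter_eq_empty_iff, funext_iff]

theorem lead_add_eq_of_lt {m : ℕ} {u v : Fin m → ZMod 2} (h : lead u < lead v) :
    lead (u + v) = lead v := by
  obtain ⟨j, hj⟩ := WithBot.ne_bot_iff_exists.1 (ne_bot_of_gt h)
  rw [← hj, lead_lt_coe_iff] at h
  rw [eq_comm, lead_eq_coe_iff] at hj
  rw [lead_eq_coe_iff.2 hj, lead_eq_coe_iff]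
  refine ⟨by simpa [h j le_rfl] using hj.1, fun k hk => ?_⟩
  simp [h k hk.le, hj.2 k hk]

theorem lead_add_eq_max {m : ℕ} {u v : Fin m → ZMod 2} (h : lead u ≠ lead v) :
    lead (u + v) = max (lead u) (lead v) := by
  rcases h.lt_or_gt with h | h
  · rw [lead_add_eq_of_lt h, max_eq_right h.le]
  · rw [add_comm, lead_add_eq_of_lt h, max_eq_left h.le]

theorem lead_add_lt {m : ℕ} {u v : Fin m → ZMod 2} {j : Fin m}
    (hu : lead u = (j : WithBot (Fin m))) (hv : lead v = (j : WithBot (Fin m))) :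
    lead (u + v) < (j : WithBot (Fin m)) := by
  rw [lead_eq_coe_iff] at hu hv
  rw [lead_lt_coe_iff]
  intro k hk
  rcases hk.eq_or_lt with rfl | hk
  · have key : ∀ a b : ZMod 2, a ≠ 0 → b ≠ 0 → a + b = 0 := by decide
    exact key _ _ hu.1 hv.1
  · simp [hu.2 k hk, hv.2 k hk]

/-- A family with one vector for each leading index spans. -/
theorem mem_span_range_of_lead_eq {m : ℕ} {w : Fin m → Fin m → ZMod 2}
    (hw : ∀ k, lead (w k) = (k : WithBot (Fin m))) (x : Fin m → ZMod 2) :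
    x ∈ Submodule.span (ZMod 2) (Set.range w) := by
  induction hx : lead x using WellFoundedLT.induction generalizing x with
  | ind a ih =>
    induction a using WithBot.recBotCoe with
    | bot =>
      rw [lead_eq_bot_iff.1 hx]
      exact zero_mem _
    | coe k =>
      have hk : w k ∈ Submodule.span (ZMod 2) (Set.range w) :=
        Submodule.subset_span ⟨k, rfl⟩
      exact (Submodule.add_mem_iff_left _ hk).1 (ih _ (lead_add_lt hx (hw k)) _ rfl)

/-- The leading index of a sum of nonzero vectors with distinct leading indices is the largest
of their leading indices. -/
theorem lead_sum_eq_sup {ι : Type*} {m : ℕ} (f : ι → Fin m → ZMod 2) (A : Finset ι)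
    (h0 : ∀ a ∈ A, f a ≠ 0) (hinj : Set.InjOn (fun a => lead (f a)) A) :
    lead (∑ a ∈ A, f a) = A.sup fun a => lead (f a) := by
  classical
  induction A using Finset.induction_on with
  | empty => simp [lead_eq_bot_iff]
  | insert a A ha ih =>
    have ih := ih (fun b hb => h0 b (Finset.mem_insert_of_mem hb))
      (hinj.mono (by simp))
    have hne : lead (f a) ≠ lead (∑ b ∈ A, f b) := by
      rw [ih]
      intro h
      rcases A.eq_empty_or_nonempty with rfl | hA
      · exact h0 a (by simp) (lead_eq_bot_iff.1 (by simpa using h))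
      · obtain ⟨b, hb, hb'⟩ := Finset.exists_mem_eq_sup A hA fun a => lead (f a)
        have : a = b := hinj (by simp) (by simp [hb]) (h.trans hb')
        exact ha (this ▸ hb)
    rw [Finset.sum_insert ha, lead_add_eq_max hne, ih, Finset.sup_insert]

theorem CurtisTable.exists_lead_eq {C : BasedComplex} (T : CurtisTable C) (i : ℕ)
    (k : Fin (C.n i)) :
    ∃ x : Fin (C.n i) → ZMod 2, lead x = (k : WithBot (Fin (C.n i))) ∧
      (C.d i x ≠ 0 → ∃ j, T.t i k = some j ∧
        lead (C.d i x) = (j : WithBot (Fin (C.n (i + 1))))) := by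
  cases ht : T.t i k with
  | some j =>
    obtain ⟨x, hx, -, hj⟩ := T.tag_spec i k j ht
    exact ⟨x, hx, fun _ => ⟨j, rfl, hj⟩⟩
  | none =>
    have hk : k ∈ LTset (C.cyc i) := by
      rw [← T.union_eq i]
      simpa [ht, or_assoc] using T.cover i k
    obtain ⟨x, hx, -, hk⟩ := hk
    exact ⟨x, hk, fun h => absurd (LinearMap.mem_ker.1 hx) h⟩

/-- The image of the tags `τ_i` is exactly `LT(im d_{i-1})`, the set of leading indices of
the nonzero boundaries in `X_i`. -/
theorem tagImage_eq_LT_bdry (C : BasedComplex) (T : CurtisTable C) (i : ℕ) :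
    tagImage C T.t i = LTset (C.bdry i) := by
  classical
  cases i with
  | zero =>
    ext j
    simp only [tagImage, LTset, C.bdry_zero, Submodule.mem_bot, Set.mem_empty_iff_false,
      Set.mem_ofPred_eq, false_iff]
    rintro ⟨v, hv, hv', -⟩
    exact hv' hv
  | succ i =>
    ext j
    constructor
    · rintro ⟨k, hk⟩
      obtain ⟨x, -, hx, hj⟩ := T.tag_spec i k j hk
      exact ⟨C.d i x, ⟨x, rfl⟩, hx, hj⟩
    · rintro ⟨_, ⟨x, rfl⟩, -, hj⟩
      choose w hw hd using T.exists_lead_eq i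
      obtain ⟨c, rfl⟩ := (Submodule.mem_span_range_iff_exists_fun (ZMod 2)).1
        (mem_span_range_of_lead_eq hw x)
      let A : Finset (Fin (C.n i)) := Finset.univ.filter fun k => c k • C.d i (w k) ≠ 0
      have hsmul : ∀ k ∈ A, C.d i (w k) ≠ 0 ∧ c k • C.d i (w k) = C.d i (w k) := by
        intro k hk
        have hk := (Finset.mem_filter.1 hk).2
        have hc : ∀ a : ZMod 2, a ≠ 0 → a = 1 := by decide
        rw [hc (c k) (left_ne_zero_of_smul hk), one_smul]
        exact ⟨right_ne_zero_of_smul hk, rfl⟩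
      have hsum : C.d i (∑ k, c k • w k) = ∑ k ∈ A, C.d i (w k) := by
        rw [map_sum, ← Finset.sum_congr rfl fun k hk => (hsmul k hk).2, Finset.sum_filter_ne_zero]
        simp only [map_smul]
      rw [hsum, lead_sum_eq_sup _ A fun k hk => (hsmul k hk).1] at hj
      · have hA : A.Nonempty := by
          by_contra hA
          simp [Finset.not_nonempty_iff_eq_empty.1 hA] at hj
        obtain ⟨k, hk, hk'⟩ := Finset.exists_mem_eq_sup A hA fun k => lead (C.d i (w k))
        obtain ⟨j', ht, hj'⟩ := hd k (hsmul k hk).1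
        have : j' = j := WithBot.coe_injective (hj'.symm.trans (hk'.symm.trans hj))
        exact ⟨k, this ▸ ht⟩
      · intro k hk k' hk' h
        obtain ⟨j₁, ht₁, hj₁⟩ := hd k (hsmul k hk).1
        obtain ⟨j₂, ht₂, hj₂⟩ := hd k' (hsmul k' hk').1
        have : j₁ = j₂ := WithBot.coe_injective (hj₁.symm.trans (h.trans hj₂))
        exact T.t_inj i k k' j₁ ht₁ (this ▸ ht₂)
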